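/- arXiv:1909.10412 — 2 statements merged into one kernel-verified Lean document; each statement's English description precedes it below -/
import Mathlib

section
/- Let X be a nonempty set, n ≥ 3, and suppose there exists an associative operation X^n → X that is quasitrivial on S^n_2 but not idempotent-quasitrivial on all tuples with at most n distinct values (i.e., the class G^n_2 \ G^n_n is nonempty). Then an associative operation F : X^n → X is quasitrivial on S^n_2 but not quasitrivial on S^n_n if and only if n is odd and there exists a unique subset Y ⊆ X with |Y| ≥ 3 such that: (a) the restriction of F to Y^n is the n-ary extension of a binary operation G on Y making (Y,G) an Abelian group of exponent 2; (b) the restriction of F to (X \ Y)^n is quasitrivial and has at most one neutral element; (c) every x ∈ X \ Y is an annihilator for the restriction of F to ({x} ∪ Y)^n. Moreover, in that case Y = E_F. -/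
variable {X : Type*}

/-- The result of substituting `F` applied to the `n` consecutive entries starting at
position `i` of the `(2n-1)`-tuple `x` (given as the first `2n-1` values of `x : ℕ → X`),
and then applying `F` to the resulting `n`-tuple. -/
def naryCompAt (n : ℕ) (F : (Fin n → X) → X) (x : ℕ → X) (i : ℕ) : X :=
  F fun j => if (j : ℕ) < i then x j
    else if (j : ℕ) = i then F (fun k => x (i + (k : ℕ)))
    else x ((j : ℕ) + n - 1)

/-- `F` is an associative `n`-ary operation. -/
def NAryAssociative (n : ℕ) (F : (Fin n → X) → X) : Prop :=
  ∀ (x : ℕ → X) (i : ℕ), i + 1 ≤ n - 1 → naryCompAt n F x i = naryCompAt n F x (i + 1)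

/-- `e` is a neutral element for the `n`-ary operation `F`: inserting the argument `a` at
any position `p`, with `e` at all the other positions, returns `a`. -/
def NAryNeutral (n : ℕ) (F : (Fin n → X) → X) (e : X) : Prop :=
  ∀ (a : X) (p : Fin n), F (Function.update (fun _ => e) p a) = a

/-- The set `E_F` of neutral elements for `F`. -/
def naryNeutralSet (n : ℕ) (F : (Fin n → X) → X) : Set X :=
  {e | NAryNeutral n F e}

/-- `e` is a neutral element for the restriction of `F` to `S^n`. -/
def NAryNeutralOn (n : ℕ) (F : (Fin n → X) → X) (S : Set X) (e : X) : Prop :=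
  e ∈ S ∧ ∀ a ∈ S, ∀ p : Fin n, F (Function.update (fun _ => e) p a) = a

/-- `iterOp G m x = G (x 0) (G (x 1) (⋯ (G (x (m-1)) (x m))⋯))`,
the `m`-fold iterate of the binary operation `G`, applied to `m+1` arguments. -/
def iterOp (G : X → X → X) : ℕ → (ℕ → X) → X
  | 0, x => x 0
  | m + 1, x => G (x 0) (iterOp G m fun i => x (i + 1))

/-- The `n`-ary operation `F` is reducible to the binary operation `G`, i.e. `F` is the
`(n-1)`-fold iterate of `G`. -/
def NAryReducibleTo (n : ℕ) (F : (Fin n → X) → X) (G : X → X → X) : Prop :=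
  ∀ x : ℕ → X, F (fun i : Fin n => x i) = iterOp G (n - 1) x

/-- `gPow G a m` is the `G`-product of `m + 1` copies of `a`. -/
def gPow (G : X → X → X) (a : X) : ℕ → X
  | 0 => a
  | m + 1 => G a (gPow G a m)

/-- `(Y, G)` is an Abelian group whose exponent divides `m` (for `m ≥ 1`): `G` maps `Y × Y`
into `Y` and is commutative and associative on `Y`, and `Y` contains a neutral element `e`
for which every element of `Y` has an inverse and such that the `G`-product of `m` copies of
any element of `Y` equals `e`. -/
def IsAbelianGroupOfExpDvdOn (Y : Set X) (G : X → X → X) (m : ℕ) : Prop :=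
  (∀ a ∈ Y, ∀ b ∈ Y, G a b ∈ Y) ∧
  (∀ a ∈ Y, ∀ b ∈ Y, G a b = G b a) ∧
  (∀ a ∈ Y, ∀ b ∈ Y, ∀ c ∈ Y, G (G a b) c = G a (G b c)) ∧
  ∃ e ∈ Y, (∀ a ∈ Y, G e a = a) ∧ (∀ a ∈ Y, ∃ b ∈ Y, G a b = e) ∧
    (∀ a ∈ Y, gPow G a (m - 1) = e)

/-- The tuple `x` lies in `D^n_k`: at least `k` of its components are equal to each other. -/
def MemD (n k : ℕ) (x : Fin n → X) : Prop :=
  ∃ S : Finset (Fin n), k ≤ S.card ∧ ∀ i ∈ S, ∀ j ∈ S, x i = x j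

/-- `F` is quasitrivial on `D^n_k`. -/
def NAryQuasitrivialOnD (n k : ℕ) (F : (Fin n → X) → X) : Prop :=
  ∀ x : Fin n → X, MemD n k x → F x ∈ Set.range x

/-- `F` is quasitrivial on `S^n_k`, the set of tuples taking at most `k` distinct values. -/
def NAryQuasitrivialOnS (n k : ℕ) (F : (Fin n → X) → X) : Prop :=
  ∀ x : Fin n → X, (Set.range x).encard ≤ k → F x ∈ Set.range x

/-- `F` is quasitrivial. -/
def NAryQuasitrivial (n : ℕ) (F : (Fin n → X) → X) : Prop :=
  ∀ x : Fin n → X, F x ∈ Set.range x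

/-- Conditions (a), (b), (c) of Theorem 3.1, together with `|Y| ≥ 3`, for a subset `Y`:
(a) `(Y, F|_{Y^n})` is the `n`-ary extension of an Abelian group of exponent `2`;
(b) `F|_{(X \ Y)^n}` is quasitrivial and has at most one neutral element;
(c) any `x ∈ X \ Y` is an annihilator for `F|_{({x} ∪ Y)^n}`. -/
def Cond17 {X : Type*} (n : ℕ) (F : (Fin n → X) → X) (Y : Set X) : Prop :=
  3 ≤ Y.encard ∧
  (∃ G : X → X → X, IsAbelianGroupOfExpDvdOn Y G 2 ∧
    ∀ x : ℕ → X, (∀ i < n, x i ∈ Y) →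
      F (fun i : Fin n => x i) = iterOp G (n - 1) x) ∧
  ((∀ y : Fin n → X, (∀ i, y i ∈ Yᶜ) → F y ∈ Set.range y) ∧
    {e | NAryNeutralOn n F Yᶜ e}.Subsingleton) ∧
  (∀ x ∈ Yᶜ, ∀ y : Fin n → X, (∀ i, y i ∈ insert x Y) → (∃ i, y i = x) → F y = x)

/-- The sequence obtained from `x` by replacing the `n` consecutive entries starting at
position `i` by the value of `F` on them. -/
def collapseAt (n : ℕ) (F : (Fin n → X) → X) (x : ℕ → X) (i : ℕ) : ℕ → X :=
  fun j => if j < i then x j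
    else if j = i then F (fun k => x (i + (k : ℕ)))
    else x (j + n - 1)

/-- The value of the first `m * (n - 1) + 1` entries of `x`, bracketed to the left. -/
def leftValue (n : ℕ) (F : (Fin n → X) → X) : ℕ → (ℕ → X) → X
  | 0, x => x 0
  | m + 1, x => leftValue n F m (collapseAt n F x 0)

theorem NAryAssociative.naryCompAt_eq {n : ℕ} {F : (Fin n → X) → X} (hF : NAryAssociative n F)
    (x : ℕ → X) : ∀ i, i ≤ n - 1 → naryCompAt n F x i = naryCompAt n F x 0
  | 0, _ => rfl
  | i + 1, h => by rw [← hF x i h, hF.naryCompAt_eq x i (by omega)]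

theorem NAryAssociative.leftValue_collapseAt {n : ℕ} {F : (Fin n → X) → X}
    (hF : NAryAssociative n F) (hn : 1 ≤ n) :
    ∀ (m : ℕ) (x : ℕ → X) (i : ℕ), i ≤ m * (n - 1) →
      leftValue n F m (collapseAt n F x i) = leftValue n F (m + 1) x
  | 0, x, i, h => by
    obtain rfl : i = 0 := by omega
    rfl
  | m + 1, x, i, h => by
    by_cases hi : i ≤ n - 1
    · simp only [leftValue]
      congr 1
      funext j
      have := hF.naryCompAt_eq x i hi
      by_cases hj : j = 0
      · subst hj
        simpa [collapseAt, naryCompAt] using this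
      · have h1 : ¬ j + n - 1 < i := by omega
        have h2 : j + n - 1 ≠ i := by omega
        have h3 : j + n - 1 ≠ 0 := by omega
        simp [collapseAt, hj, h1, h2, h3]
    · have key : collapseAt n F (collapseAt n F x i) 0 =
          collapseAt n F (collapseAt n F x 0) (i - (n - 1)) := by
        funext j
        by_cases hj : j = 0
        · subst hj
          have h1 : 0 < i - (n - 1) := by omega
          simp only [collapseAt, lt_irrefl, if_true, if_false, h1, zero_add]
          congr 1
          funext k
          have : (k : ℕ) < i := by omega
          simp [this]
        · rcases lt_trichotomy j (i - (n - 1)) with h1 | h1 | h1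
          · have h2 : j + n - 1 < i := by omega
            simp [collapseAt, hj, h1, h2]
          · have h2 : ¬ j + n - 1 < i := by omega
            have h3 : j + n - 1 = i := by omega
            have h4 : i - (n - 1) ≠ 0 := by omega
            simp only [collapseAt, h1, h4, if_false, not_lt_zero, lt_irrefl, if_true]
            rw [if_neg (by omega), if_pos (by omega)]
            congr 1
            funext k
            rw [if_neg (by omega)]
            congr 1
            omega
          · have h2 : ¬ j + n - 1 < i := by omega
            have h3 : j + n - 1 ≠ i := by omega
            have h4 : ¬ j < i - (n - 1) := by omega
            have h5 : j ≠ i - (n - 1) := by omega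
            have h6 : j + n - 1 ≠ 0 := by omega
            simp [collapseAt, hj, h2, h3, h4, h5, h6]
      have hm : i - (n - 1) ≤ m * (n - 1) := by
        rw [Nat.succ_mul] at h
        omega
      rw [leftValue, key, hF.leftValue_collapseAt hn m _ _ hm]
      rfl

open Classical in
/-- The value of a word under an `n`-ary operation: its iterated `F`-product when the length
of the word is congruent to `1` modulo `n - 1`, and `d` otherwise. -/
noncomputable def wordValue (n : ℕ) (F : (Fin n → X) → X) (d : X) (l : List X) : X :=
  if l.length % (n - 1) = 1 % (n - 1) ∧ l ≠ [] then
    leftValue n F ((l.length - 1) / (n - 1)) (fun j => l.getD j d) else d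

theorem NAryAssociative.wordValue_collapse {n : ℕ} {F : (Fin n → X) → X}
    (hF : NAryAssociative n F) (hn : 2 ≤ n) (d : X) (p q : List X) (x : Fin n → X) :
    wordValue n F d (p ++ List.ofFn x ++ q) = wordValue n F d (p ++ [F x] ++ q) := by
  have e1 : (p ++ List.ofFn x ++ q).length = (p ++ [F x] ++ q).length + (n - 1) := by
    simp; omega
  have e2 : p ++ List.ofFn x ++ q ≠ [] := by
    intro h
    rw [h] at e1
    simp at e1
    omega
  have e3 : p ++ [F x] ++ q ≠ [] := by simp
  unfold wordValue
  rw [e1, Nat.add_mod_right]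
  by_cases h : (p ++ [F x] ++ q).length % (n - 1) = 1 % (n - 1)
  swap
  · simp only [h, false_and, if_false]
  rw [if_pos ⟨h, e2⟩, if_pos ⟨h, e3⟩]
  have hpos : 0 < (p ++ [F x] ++ q).length := List.length_pos_of_ne_nil e3
  have hdvd : (n - 1) ∣ (p ++ [F x] ++ q).length - 1 := (Nat.modEq_iff_dvd' hpos).1 h.symm
  have hdiv : ((p ++ [F x] ++ q).length + (n - 1) - 1) / (n - 1) =
      ((p ++ [F x] ++ q).length - 1) / (n - 1) + 1 := by
    rw [← Nat.add_div_right _ (by omega)]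
    congr 1
    omega
  rw [hdiv, ← hF.leftValue_collapseAt (by omega) _ _ p.length]
  · congr 1
    funext j
    simp only [collapseAt]
    rcases lt_trichotomy j p.length with h1 | h1 | h1
    · simp [h1, List.getD_eq_getElem?_getD, List.getElem?_append]
    · subst h1
      simp [List.getD_eq_getElem?_getD, List.getElem?_append]
    · have h2 : ¬ j < p.length := by omega
      have h3 : j ≠ p.length := by omega
      have h4 : ¬ j + n - 1 < p.length := by omega
      have h5 : ¬ j + n - 1 - p.length < n := by omega
      have h6 : j - p.length ≠ 0 := by omega
      have h7 : j + n - 1 - p.length - n = j - p.length - 1 := by omega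
      simp [List.getD_eq_getElem?_getD, List.getElem?_append, List.getElem?_cons,
        h2, h3, h4, h5, h6, h7]
  · rw [Nat.div_mul_cancel hdvd]
    simp

/-- The syntactic congruence of `wordValue`. -/
def wordCon (n : ℕ) (F : (Fin n → X) → X) (d : X) : Con (FreeMonoid X) where
  r u v := ∀ p q : FreeMonoid X, wordValue n F d (p * u * q).toList =
    wordValue n F d (p * v * q).toList
  iseqv := ⟨fun _ _ _ => rfl, fun h p q => (h p q).symm, fun h h' p q => (h p q).trans (h' p q)⟩
  mul' {a b c e} h h' p q := by
    have h1 := h p (c * q)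
    have h2 := h' (p * b) q
    simp only [mul_assoc] at h1 h2 ⊢
    rw [h1, h2]

universe u

/-- Every `n`-ary semigroup embeds into a monoid in which `F` becomes the `n`-fold product. -/
theorem NAryAssociative.exists_monoid {X : Type u} [Nonempty X] {n : ℕ} {F : (Fin n → X) → X}
    (hF : NAryAssociative n F) (hn : 2 ≤ n) :
    ∃ (M : Type u) (_ : Monoid M) (ι : X → M), Function.Injective ι ∧
      ∀ x : Fin n → X, ι (F x) = ((List.ofFn x).map ι).prod := by
  obtain ⟨d⟩ := ‹Nonempty X›
  refine ⟨(wordCon n F d).Quotient, inferInstance,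
    fun x => ((FreeMonoid.of x : FreeMonoid X) : (wordCon n F d).Quotient), ?_, ?_⟩
  · intro a b hab
    have := (Con.eq _).1 hab 1 1
    simpa [wordValue, leftValue] using this
  · intro x
    have h1 : ((List.ofFn x).map fun y =>
        ((FreeMonoid.of y : FreeMonoid X) : (wordCon n F d).Quotient)).prod =
        ((FreeMonoid.ofList (List.ofFn x) : FreeMonoid X) : (wordCon n F d).Quotient) := by
      generalize List.ofFn x = l
      induction l with
      | nil => rfl
      | cons a l ih =>
        rw [List.map_cons, List.prod_cons, ih]
        rfl
    rw [h1]
    refine (Con.eq _).2 fun p q => ?_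
    exact (hF.wordValue_collapse hn d p.toList q.toList x).symm

section MonoidEmbedding

variable {M : Type*} [Monoid M]

theorem mul_pow_of_mul_eq_sq_left {a b : M} (h : a * b = a ^ 2) (j : ℕ) :
    a * b ^ j = a ^ (j + 1) := by
  induction j with
  | zero => simp
  | succ j ih => rw [pow_succ, ← mul_assoc, ih, pow_succ, mul_assoc, h, ← pow_add]

theorem pow_mul_of_mul_eq_sq_right {a b : M} (h : a * b = b ^ 2) (j : ℕ) :
    a ^ j * b = b ^ (j + 1) := by
  induction j with
  | zero => simp
  | succ j ih => rw [pow_succ', mul_assoc, ih, pow_succ', ← mul_assoc, h, ← pow_add, add_comm]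

theorem mul_eq_sq_left {a b : M} {k : ℕ} (ha : a ^ (k + 2) = a) (h : a ^ (k + 1) * b = a) :
    a * b = a ^ 2 := by
  rw [← ha, pow_succ' a (k + 1), mul_assoc, h, ← pow_succ', ha, sq]

theorem mul_eq_sq_right {a b : M} {k : ℕ} (hb : b ^ (k + 2) = b) (h : a * b ^ (k + 1) = b) :
    a * b = b ^ 2 := by
  have : a * b ^ (k + 2) = b ^ 2 := by rw [pow_succ b (k + 1), ← mul_assoc, h, sq]
  rwa [hb] at this

/-- An injection of `X` into a monoid whose image is closed under `(k + 2)`-fold products, these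
products being quasitrivial on words `x ⋯ x y ⋯ y x ⋯ x`. -/
structure QuasitrivialEmbedding (k : ℕ) (ι : X → M) : Prop where
  inj : Function.Injective ι
  closed : ∀ l : List X, l.length = k + 2 → ∃ c, ι c = (l.map ι).prod
  quasitrivial : ∀ x y i j m, i + j + m = k + 2 →
    ι x ^ i * ι y ^ j * ι x ^ m = ι x ∨ ι x ^ i * ι y ^ j * ι x ^ m = ι y

/-- The elements `x` which share the idempotent `x ^ (k + 1)` with another element. -/
def sharedClass (k : ℕ) (ι : X → M) : Set X :=
  {x | ∃ y, y ≠ x ∧ ι y ^ (k + 1) = ι x ^ (k + 1)}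

namespace QuasitrivialEmbedding

variable {k : ℕ} {ι : X → M}

theorem pow_eq (h : QuasitrivialEmbedding k ι) (x : X) : ι x ^ (k + 2) = ι x := by
  simpa using h.quasitrivial x x (k + 2) 0 0 (by omega)

theorem idem_mul (h : QuasitrivialEmbedding k ι) (x y : X) :
    ι x ^ (k + 1) * ι y = ι x ∨ ι x ^ (k + 1) * ι y = ι y := by
  simpa using h.quasitrivial x y (k + 1) 1 0 (by omega)

theorem mul_idem (h : QuasitrivialEmbedding k ι) (x y : X) :
    ι x * ι y ^ (k + 1) = ι x ∨ ι x * ι y ^ (k + 1) = ι y := by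
  simpa using h.quasitrivial x y 1 (k + 1) 0 (by omega)

theorem idem_mul_self (h : QuasitrivialEmbedding k ι) (x : X) : ι x ^ (k + 1) * ι x = ι x := by
  rw [← pow_succ, h.pow_eq]

theorem mul_idem_self (h : QuasitrivialEmbedding k ι) (x : X) : ι x * ι x ^ (k + 1) = ι x := by
  rw [← pow_succ', h.pow_eq]

theorem idem_mul_idem_right {x y : X}
    (hxy : ι x ^ (k + 1) * ι y = ι y) : ι x ^ (k + 1) * ι y ^ (k + 1) = ι y ^ (k + 1) := by
  rw [pow_succ' (ι y), ← mul_assoc, hxy]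

theorem idem_mul_idem_left {x y : X}
    (hxy : ι x * ι y ^ (k + 1) = ι x) : ι x ^ (k + 1) * ι y ^ (k + 1) = ι x ^ (k + 1) := by
  rw [pow_succ (ι x), mul_assoc, hxy]

theorem idem_pow (h : QuasitrivialEmbedding k ι) (x : X) (j : ℕ) :
    (ι x ^ (k + 1)) ^ (j + 1) = ι x ^ (k + 1) := by
  induction j with
  | zero => simp
  | succ j ih => rw [pow_succ, ih, idem_mul_idem_left (h.mul_idem_self x)]

/-- Elements with different idempotents multiply to one of their squares. -/
theorem mul_eq_sq_or (h : QuasitrivialEmbedding k ι) {x y : X}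
    (hxy : ι x ^ (k + 1) ≠ ι y ^ (k + 1)) :
    ι x * ι y = ι x ^ 2 ∨ ι x * ι y = ι y ^ 2 := by
  rcases h.idem_mul x y with h1 | h1
  · exact Or.inl (mul_eq_sq_left (h.pow_eq x) h1)
  rcases h.mul_idem x y with h2 | h2
  · exact absurd ((idem_mul_idem_left h2).symm.trans (idem_mul_idem_right h1)) hxy
  · exact Or.inr (mul_eq_sq_right (h.pow_eq y) h2)

theorem mul_eq_sq_or_of_notMem (h : QuasitrivialEmbedding k ι) {x y : X}
    (hy : y ∉ sharedClass k ι) : ι x * ι y = ι x ^ 2 ∨ ι x * ι y = ι y ^ 2 := by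
  by_cases hxy : x = y
  · subst hxy
    exact Or.inl (sq _).symm
  · exact h.mul_eq_sq_or fun he => hy ⟨x, hxy, he⟩

theorem idem_mul_of_mem (h : QuasitrivialEmbedding k ι) {x : X} (hx : x ∈ sharedClass k ι)
    (z : X) : ι x ^ (k + 1) * ι z = ι z := by
  obtain ⟨y, hyx, he⟩ := hx
  have h1 := h.idem_mul x z
  have h2 := h.idem_mul y z
  rw [he] at h2
  rcases h1 with h1 | h1
  · rcases h2 with h2 | h2
    · exact absurd (h.inj (h2.symm.trans h1)) hyx
    · exact h2
  · exact h1

theorem mul_idem_of_mem (h : QuasitrivialEmbedding k ι) {x : X} (hx : x ∈ sharedClass k ι)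
    (z : X) : ι z * ι x ^ (k + 1) = ι z := by
  obtain ⟨y, hyx, he⟩ := hx
  have h1 := h.mul_idem z x
  have h2 := h.mul_idem z y
  rw [he] at h2
  rcases h1 with h1 | h1
  · exact h1
  · rcases h2 with h2 | h2
    · exact h2
    · exact absurd (h.inj (h2.symm.trans h1)) hyx

theorem idem_eq_of_mem (h : QuasitrivialEmbedding k ι) {x y : X} (hx : x ∈ sharedClass k ι)
    (hy : y ∈ sharedClass k ι) : ι x ^ (k + 1) = ι y ^ (k + 1) :=
  (idem_mul_idem_left (h.mul_idem_of_mem hy x)).symm.trans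
    (idem_mul_idem_right (h.idem_mul_of_mem hx y))

theorem mem_of_idem_eq {x y : X} (hx : x ∈ sharedClass k ι)
    (hxy : ι y ^ (k + 1) = ι x ^ (k + 1)) : y ∈ sharedClass k ι := by
  obtain ⟨z, hzx, hz⟩ := hx
  by_cases hyx : y = x
  · subst hyx
    exact ⟨z, hzx, hz⟩
  · exact ⟨x, Ne.symm hyx, hxy.symm⟩

theorem mul_of_mem_of_notMem (h : QuasitrivialEmbedding k ι) {x z : X}
    (hx : x ∈ sharedClass k ι) (hz : z ∉ sharedClass k ι) : ι x * ι z = ι z ^ 2 := by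
  refine (h.mul_eq_sq_or_of_notMem hz).resolve_left fun hs => hz ?_
  have h1 := h.idem_mul_of_mem hx z
  rw [pow_succ, mul_assoc, hs, ← pow_add, h.pow_eq] at h1
  exact h.inj h1 ▸ hx

theorem mul_of_notMem_of_mem (h : QuasitrivialEmbedding k ι) {x z : X}
    (hx : x ∈ sharedClass k ι) (hz : z ∉ sharedClass k ι) : ι z * ι x = ι z ^ 2 := by
  have hne : ι z ^ (k + 1) ≠ ι x ^ (k + 1) := fun he => hz (mem_of_idem_eq hx he)
  refine (h.mul_eq_sq_or hne).resolve_right fun hs => hz ?_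
  have h1 := h.mul_idem_of_mem hx z
  rw [pow_succ', ← mul_assoc, hs, ← pow_add, add_comm, h.pow_eq] at h1
  exact h.inj h1 ▸ hx

theorem sq_eq_sq (h : QuasitrivialEmbedding k ι) {x y : X}
    (hx : x ∈ sharedClass k ι) (hy : y ∈ sharedClass k ι) : ι x ^ 2 = ι y ^ 2 := by
  have hyx := h.mul_idem_of_mem hy x
  rcases h.quasitrivial x y 2 k 0 (by omega) with h1 | h1
  · rw [pow_zero, mul_one] at h1
    have h2 : ι x * ι y ^ k = ι x ^ (k + 1) := by
      calc ι x * ι y ^ k = ι x ^ (k + 2) * ι y ^ k := by rw [h.pow_eq]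
        _ = ι x ^ k * (ι x ^ 2 * ι y ^ k) := by rw [pow_add, mul_assoc]
        _ = ι x ^ (k + 1) := by rw [h1, pow_succ]
    have h3 := h.idem_mul_of_mem hx y
    rw [← h2, mul_assoc, ← pow_succ, hyx] at h3
    rw [h3]
  · rw [pow_zero, mul_one] at h1
    calc ι x ^ 2 = ι x * (ι x * ι y ^ (k + 1)) := by rw [hyx, sq]
      _ = ι x ^ 2 * ι y ^ k * ι y := by rw [pow_succ, sq]; simp only [mul_assoc]
      _ = ι y ^ 2 := by rw [h1, sq]

theorem mul_comm_of_mem (h : QuasitrivialEmbedding k ι) {x : X}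
    (hx : x ∈ sharedClass k ι) (y : X) : ι x * ι y = ι y * ι x := by
  have e1 : ι x ^ 1 * ι y ^ 1 * ι x ^ k * ι x = ι x * ι y := by
    rw [pow_one, pow_one, mul_assoc, ← pow_succ, mul_assoc, h.mul_idem_of_mem hx]
  rcases h.quasitrivial x y 1 1 k (by omega) with h1 | h1
  · rw [h1] at e1
    have h2 := h.idem_mul_of_mem hx y
    rw [pow_succ, mul_assoc, ← e1, ← sq, ← pow_add, h.pow_eq] at h2
    rw [h2]
  · rw [← e1, h1]

theorem odd_of_mem (h : QuasitrivialEmbedding k ι) {x : X} (hx : x ∈ sharedClass k ι) :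
    Odd (k + 2) := by
  rw [← Nat.not_even_iff_odd]
  rintro ⟨m, hm⟩
  obtain ⟨y, hyx, he⟩ := hx
  have hs := h.sq_eq_sq (x := y) (mem_of_idem_eq ⟨y, hyx, he⟩ he) ⟨y, hyx, he⟩
  refine hyx (h.inj ?_)
  rw [← h.pow_eq y, ← h.pow_eq x, hm, ← two_mul, pow_mul, hs, pow_mul]

/-- A nonempty word with a letter outside the shared class is equal to a power of such a
letter. -/
theorem exists_prod_eq_pow (h : QuasitrivialEmbedding k ι) (l : List X) :
    (∀ a ∈ l, a ∈ sharedClass k ι) ∨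
      ∃ z ∈ l, z ∉ sharedClass k ι ∧ (l.map ι).prod = ι z ^ l.length := by
  have hpow : ∀ x ∈ sharedClass k ι, ∀ z ∉ sharedClass k ι, ∀ j,
      ι x * ι z ^ (j + 1) = ι z ^ (j + 2) := fun x hx z hz j => by
    rw [pow_succ', ← mul_assoc, h.mul_of_mem_of_notMem hx hz, ← pow_add, add_comm]
  induction l with
  | nil => simp
  | cons a l ih =>
    simp only [List.map_cons, List.prod_cons, List.length_cons, List.forall_mem_cons,
      List.exists_mem_cons_iff]
    rcases ih with ih | ⟨z, hzl, hz, hp⟩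
    · by_cases ha : a ∈ sharedClass k ι
      · exact Or.inl ⟨ha, ih⟩
      · refine Or.inr (Or.inl ⟨ha, ?_⟩)
        clear * - h ha ih
        induction l using List.reverseRecOn with
        | nil => simp
        | append_singleton l b ihl =>
          have hb : b ∈ sharedClass k ι := ih b (by simp)
          have := ihl fun c hc => ih c (by simp [hc])
          rw [List.map_append, List.prod_append, ← mul_assoc, this, List.map_singleton,
            List.prod_singleton, pow_succ, mul_assoc, h.mul_of_notMem_of_mem hb ha, ← pow_add,
            List.length_append, List.length_singleton]
    · right
      have hlen : l.length = (l.length - 1) + 1 := by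
        have := List.length_pos_of_mem hzl
        omega
      by_cases ha : a ∈ sharedClass k ι
      · exact Or.inr ⟨z, hzl, hz, by rw [hp, hlen, hpow a ha z hz]⟩
      · rcases h.mul_eq_sq_or_of_notMem (x := a) hz with h1 | h1
        · exact Or.inl ⟨ha, by rw [hp, mul_pow_of_mul_eq_sq_left h1]⟩
        · refine Or.inr ⟨z, hzl, hz, ?_⟩
          rw [hp, hlen, pow_succ', ← mul_assoc, h1, ← pow_add, add_comm]

theorem iterOp_eq (h : QuasitrivialEmbedding k ι) {u : X} (hu : u ∈ sharedClass k ι)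
    {G : X → X → X} (hG : ∀ a b, ι (G a b) = ι a * ι u ^ k * ι b) (j : ℕ) (x : ℕ → X) :
    ι (iterOp G j x) =
      (ι u ^ k) ^ j * ((List.ofFn fun i : Fin (j + 1) => x i).map ι).prod := by
  induction j generalizing x with
  | zero => simp [iterOp]
  | succ j ih =>
    have hc : Commute (ι (x 0)) ((ι u ^ k) ^ (j + 1)) :=
      (show Commute (ι (x 0)) (ι u) from (h.mul_comm_of_mem hu (x 0)).symm).pow_right k
        |>.pow_right (j + 1)
    rw [iterOp, hG, ih, List.ofFn_succ, List.map_cons, List.prod_cons, mul_assoc,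
      ← mul_assoc (ι u ^ k), ← pow_succ', ← mul_assoc, hc.eq, mul_assoc]
    simp

theorem op_mem (h : QuasitrivialEmbedding k ι) {u a b c : X} (hk : 1 ≤ k)
    (hu : u ∈ sharedClass k ι) (ha : a ∈ sharedClass k ι) (hb : b ∈ sharedClass k ι)
    (hc : ι c = ι a * ι u ^ k * ι b) : c ∈ sharedClass k ι := by
  have hua : Commute (ι a) (ι u ^ k) := Commute.pow_right (h.mul_comm_of_mem ha u) k
  have hab : Commute (ι a * ι u ^ k) (ι b) :=
    Commute.symm <| Commute.mul_right (h.mul_comm_of_mem hb a)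
      (Commute.pow_right (h.mul_comm_of_mem hb u) k)
  obtain ⟨j, rfl⟩ : ∃ j, k = j + 1 := ⟨k - 1, by omega⟩
  refine mem_of_idem_eq hu ?_
  rw [hc, hab.mul_pow, hua.mul_pow, h.idem_eq_of_mem ha hu, h.idem_eq_of_mem hb hu,
    pow_right_comm, h.idem_pow, idem_mul_idem_left (h.mul_idem_self u),
    idem_mul_idem_left (h.mul_idem_self u)]

end QuasitrivialEmbedding

end MonoidEmbedding

theorem exists_ofFn_eq {n : ℕ} (l : List X) (hl : l.length = n) :
    ∃ x : Fin n → X, List.ofFn x = l ∧ ∀ i, x i ∈ l := by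
  subst hl
  exact ⟨l.get, List.ofFn_get l, fun i => List.get_mem l i⟩

theorem exists_quasitrivialEmbedding {X : Type u} [Nonempty X] {k : ℕ}
    {F : (Fin (k + 2) → X) → X} (hF : NAryAssociative (k + 2) F)
    (hq : NAryQuasitrivialOnS (k + 2) 2 F) :
    ∃ (M : Type u) (_ : Monoid M) (ι : X → M), QuasitrivialEmbedding k ι ∧
      ∀ x : Fin (k + 2) → X, ι (F x) = ((List.ofFn x).map ι).prod := by
  obtain ⟨M, _, ι, hinj, hι⟩ := hF.exists_monoid (by omega)
  refine ⟨M, _, ι, ⟨hinj, fun l hl => ?_, fun x y i j m hs => ?_⟩, hι⟩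
  · obtain ⟨x, hx, -⟩ := exists_ofFn_eq l hl
    exact ⟨F x, by rw [hι, hx]⟩
  · obtain ⟨t, ht, hmem⟩ := exists_ofFn_eq (n := k + 2)
      (List.replicate i x ++ List.replicate j y ++ List.replicate m x) (by simp; omega)
    have hxy : ∀ p, t p = x ∨ t p = y := fun p => by
      have := hmem p
      simp only [List.mem_append, List.mem_replicate] at this
      tauto
    have hsub : Set.range t ⊆ {x, y} := by
      rintro _ ⟨p, rfl⟩
      exact hxy p
    obtain ⟨p, hp⟩ := hq t ((Set.encard_le_encard hsub).trans ((Set.encard_insert_le _ _).trans (by simp [one_add_one_eq_two])))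
    have hprod := hι t
    rw [ht, ← hp] at hprod
    simp only [List.map_append, List.map_replicate, List.prod_append, List.prod_replicate]
      at hprod
    rw [← hprod]
    exact (hxy p).imp (congrArg ι) (congrArg ι)

/-- An associative operation which is quasitrivial on `S^n_2` but not quasitrivial has odd arity
and satisfies `Cond17` for some set. -/
theorem exists_cond17 {X : Type*} [Nonempty X] {n : ℕ} (hn : 3 ≤ n)
    {F : (Fin n → X) → X} (hF : NAryAssociative n F) (hq : NAryQuasitrivialOnS n 2 F)
    (hnq : ¬ NAryQuasitrivial n F) : Odd n ∧ ∃ Y : Set X, Cond17 n F Y := by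
  obtain ⟨k, rfl⟩ : ∃ k, n = k + 2 := ⟨n - 2, by omega⟩
  have hk : 1 ≤ k := by omega
  obtain ⟨M, _, ι, h, hι⟩ := exists_quasitrivialEmbedding hF hq
  have hout : ∀ x : Fin (k + 2) → X, (∀ i, x i ∈ sharedClass k ι) ∨
      ∃ i, x i ∉ sharedClass k ι ∧ F x = x i := fun x => by
    rcases h.exists_prod_eq_pow (List.ofFn x) with h1 | ⟨z, hzl, hz, hp⟩
    · exact Or.inl fun i => h1 _ (List.mem_ofFn.2 ⟨i, rfl⟩)
    · obtain ⟨i, rfl⟩ := List.mem_ofFn.1 hzl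
      rw [← hι, List.length_ofFn, h.pow_eq] at hp
      exact Or.inr ⟨i, hz, h.inj hp⟩
  have hcard : 3 ≤ (sharedClass k ι).encard := by
    by_contra hlt
    refine hnq fun x => ?_
    rcases hout x with h1 | ⟨i, -, h1⟩
    · refine hq x ((Set.encard_le_encard (Set.range_subset_iff.2 h1)).trans ?_)
      exact Order.le_of_lt_succ (by simpa [Order.succ_eq_add_one, one_add_one_eq_two,
        two_add_one_eq_three] using hlt)
    · exact ⟨i, h1.symm⟩
  obtain ⟨u, hu⟩ : (sharedClass k ι).Nonempty := by
    rw [← Set.encard_pos]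
    exact lt_of_lt_of_le (by norm_num) hcard
  have hannih : ∀ x ∈ (sharedClass k ι)ᶜ, ∀ y : Fin (k + 2) → X,
      (∀ i, y i ∈ insert x (sharedClass k ι)) → (∃ i, y i = x) → F y = x := by
    rintro x hx y hy ⟨i, hi⟩
    rcases hout y with h1 | ⟨j, h1, h2⟩
    · exact absurd (hi ▸ h1 i) hx
    · rw [h2]
      exact (hy j).resolve_right h1
  refine ⟨h.odd_of_mem hu, sharedClass k ι, hcard, ?_, ⟨fun y hy => ?_, ?_⟩, hannih⟩
  · have hex : ∀ a b, ∃ c, ι c = ι a * ι u ^ k * ι b := fun a b => by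
      obtain ⟨c, hc⟩ := h.closed (a :: (List.replicate k u ++ [b])) (by simp)
      exact ⟨c, by simpa [mul_assoc] using hc⟩
    choose G hG using hex
    have hunit : ∀ a, G u a = a := fun a => h.inj <| by
      rw [hG, ← pow_succ', h.idem_mul_of_mem hu]
    have hsq : ∀ a ∈ sharedClass k ι, G a a = u := fun a ha => h.inj <| by
      rw [hG, mul_assoc, ((show Commute (ι a) (ι u) from h.mul_comm_of_mem ha u).pow_right
        k).symm.eq, ← mul_assoc, ← sq, h.sq_eq_sq ha hu, ← pow_add, add_comm, h.pow_eq]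
    refine ⟨G, ⟨fun a ha b hb => h.op_mem hk hu ha hb (hG a b), fun a ha b hb => h.inj ?_,
      fun a _ b _ c _ => h.inj ?_, u, hu, fun a _ => hunit a, fun a ha => ⟨a, ha, hsq a ha⟩,
      hsq⟩, fun x _ => h.inj ?_⟩
    · have h1 : Commute (ι a) (ι u ^ k) := Commute.pow_right (h.mul_comm_of_mem ha u) k
      have h2 : Commute (ι b) (ι u ^ k) := Commute.pow_right (h.mul_comm_of_mem hb u) k
      rw [hG, hG, h1.eq, h2.eq, mul_assoc, mul_assoc, h.mul_comm_of_mem ha b]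
    · simp only [hG, mul_assoc]
    · obtain ⟨j, rfl⟩ : ∃ j, k = j + 1 := ⟨k - 1, by omega⟩
      have := h.iterOp_eq hu hG (j + 1 + 1) x
      rw [show j + 1 + 2 - 1 = j + 1 + 1 by omega, this, ← hι, pow_right_comm, h.idem_pow,
        h.idem_mul_of_mem hu]
  · rcases hout y with h1 | ⟨i, -, h1⟩
    · exact absurd (h1 0) (hy 0)
    · exact ⟨i, h1.symm⟩
  · rintro e ⟨he, hne⟩ f ⟨hf, hnf⟩
    by_contra hef
    have h1 : ι e * ι f ^ (k + 1) = ι e := by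
      have := hι (Function.update (fun _ => f) 0 e)
      rw [hnf e he, List.ofFn_succ] at this
      simpa [pow_succ', mul_assoc] using this.symm
    have h2 : ι e ^ (k + 1) * ι f = ι f := by
      have := hι (Function.update (fun _ => e) (Fin.last (k + 1)) f)
      rw [hne f hf, List.ofFn_succ'] at this
      simpa [Fin.castSucc_ne_last, pow_succ', mul_assoc] using this.symm
    have h3 : ι e ^ (k + 1) = ι f ^ (k + 1) :=
      (QuasitrivialEmbedding.idem_mul_idem_left h1).symm.trans
        (QuasitrivialEmbedding.idem_mul_idem_right h2)
    exact he ⟨f, fun hfe => hef hfe.symm, h3.symm⟩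

section ElementaryAbelian

variable {Y : Set X} {G : X → X → X}

theorem IsAbelianGroupOfExpDvdOn.mul_mul_cancel (hG : IsAbelianGroupOfExpDvdOn Y G 2) {a b : X}
    (ha : a ∈ Y) (hb : b ∈ Y) : G a (G a b) = b := by
  obtain ⟨-, -, hassoc, e, -, hunit, -, hsq⟩ := hG
  rw [← hassoc a ha a ha b hb, show G a a = e from hsq a ha, hunit b hb]

theorem IsAbelianGroupOfExpDvdOn.iterOp_pair (hG : IsAbelianGroupOfExpDvdOn Y G 2) {a b : X}
    (ha : a ∈ Y) (hb : b ∈ Y) (j : ℕ) (x : ℕ → X) (hx : ∀ i ≤ j, x i = a ∨ x i = b) :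
    (Even j → iterOp G j x = a ∨ iterOp G j x = b) ∧
      (Odd j → iterOp G j x = G a a ∨ iterOp G j x = G a b) := by
  have hcomm := hG.2.1 a ha b hb
  have hab := hG.mul_mul_cancel ha hb
  have hba : G b (G a b) = a := hcomm ▸ hG.mul_mul_cancel hb ha
  have haa := hG.mul_mul_cancel ha ha
  have hsq : G b b = G a a := by
    obtain ⟨-, -, -, e, -, -, -, hsq⟩ := hG
    exact (hsq b hb).trans (hsq a ha).symm
  have hbb : G b (G a a) = b := hsq ▸ hG.mul_mul_cancel hb hb
  induction j generalizing x with
  | zero => simpa [iterOp] using hx 0 le_rfl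
  | succ j ih =>
    obtain ⟨he, ho⟩ := ih (fun i => x (i + 1)) fun i hi => hx (i + 1) (by omega)
    refine ⟨fun hj => ?_, fun hj => ?_⟩
    · rw [Nat.even_add_one, Nat.not_even_iff_odd] at hj
      rw [iterOp]
      rcases hx 0 (by omega) with h | h <;> rcases ho hj with h' | h' <;> simp [h, h', hab, hba, haa, hbb]
    · rw [Nat.odd_add_one, Nat.not_odd_iff_even] at hj
      rw [iterOp]
      rcases hx 0 (by omega) with h | h <;> rcases he hj with h' | h' <;> simp [h, h', hsq, hcomm]

theorem IsAbelianGroupOfExpDvdOn.iterOp_const (hG : IsAbelianGroupOfExpDvdOn Y G 2) {a : X}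
    (ha : a ∈ Y) (j : ℕ) (x : ℕ → X) (hx : ∀ i ≤ j, x i = a) :
    (Even j → iterOp G j x = a) ∧ (Odd j → iterOp G j x = G a a) := by
  simpa using hG.iterOp_pair ha ha j x (by simpa using hx)

theorem IsAbelianGroupOfExpDvdOn.iterOp_single (hG : IsAbelianGroupOfExpDvdOn Y G 2) {a b : X}
    (ha : a ∈ Y) (hb : b ∈ Y) (j p : ℕ) (hp : p ≤ j) (x : ℕ → X) (hxp : x p = b)
    (hx : ∀ i ≤ j, i ≠ p → x i = a) :
    (Even j → iterOp G j x = b) ∧ (Odd j → iterOp G j x = G a b) := by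
  have hab := hG.mul_mul_cancel ha hb
  have hcomm := hG.2.1 a ha b hb
  have hsq : G b b = G a a := by
    obtain ⟨-, -, -, e, -, -, -, hsq⟩ := hG
    exact (hsq b hb).trans (hsq a ha).symm
  have hbb : G b (G a a) = b := hsq ▸ hG.mul_mul_cancel hb hb
  induction j generalizing x p with
  | zero =>
    obtain rfl : p = 0 := by omega
    simpa [iterOp] using hxp
  | succ j ih =>
    rw [Nat.even_add_one, Nat.not_even_iff_odd, Nat.odd_add_one, Nat.not_odd_iff_even, iterOp]
    cases p with
    | zero =>
      obtain ⟨he, ho⟩ := hG.iterOp_const ha j (fun i => x (i + 1)) fun i hi =>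
        hx (i + 1) (by omega) (by omega)
      exact ⟨fun h => by rw [ho h, hxp, hbb], fun h => by rw [he h, hxp, hcomm]⟩
    | succ p =>
      obtain ⟨he, ho⟩ := ih p (by omega) (fun i => x (i + 1)) hxp fun i hi hip =>
        hx (i + 1) (by omega) (by omega)
      rw [hx 0 (by omega) (by omega)]
      exact ⟨fun h => by rw [ho h, hab], fun h => by rw [he h]⟩

end ElementaryAbelian

theorem exists_extend_fin {n : ℕ} (hn : 0 < n) (y : Fin n → X) :
    ∃ x : ℕ → X, (fun i : Fin n => x i) = y ∧ ∀ i : Fin n, x i = y i := by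
  refine ⟨fun i => if h : i < n then y ⟨i, h⟩ else y ⟨0, hn⟩, ?_, ?_⟩
  · funext i
    simp
  · simp

theorem exists_eq_pair_of_encard_range_le_two {n : ℕ} (hn : 0 < n) (y : Fin n → X)
    (hy : (Set.range y).encard ≤ 2) : ∃ a b, Set.range y = {a, b} := by
  by_cases h : ∃ i, y i ≠ y ⟨0, hn⟩
  · obtain ⟨i, hi⟩ := h
    refine ⟨y i, y ⟨0, hn⟩,
      ((Set.toFinite _).eq_of_subset_of_encard_le ?_ ?_).symm⟩
    · rintro _ (rfl | rfl) <;> exact ⟨_, rfl⟩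
    · rwa [Set.encard_pair hi]
  · push Not at h
    refine ⟨y ⟨0, hn⟩, y ⟨0, hn⟩, Set.Subset.antisymm ?_ ?_⟩
    · rintro _ ⟨i, rfl⟩
      simp [h i]
    · simp

theorem Cond17.quasitrivialOnS {n : ℕ} {F : (Fin n → X) → X} {Y : Set X}
    (hY : Cond17 n F Y) (hn : Odd n) : NAryQuasitrivialOnS n 2 F := by
  obtain ⟨-, ⟨G, hG, hFG⟩, ⟨hq, -⟩, hann⟩ := hY
  intro y hy
  obtain ⟨a, b, hab⟩ := exists_eq_pair_of_encard_range_le_two hn.pos y hy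
  have hmem : ∀ i, y i = a ∨ y i = b := fun i => by
    have : y i ∈ Set.range y := ⟨i, rfl⟩
    rwa [hab] at this
  have hra : ∃ i, y i = a := by
    have : a ∈ Set.range y := by simp [hab]
    exact this
  have hrb : ∃ i, y i = b := by
    have : b ∈ Set.range y := by simp [hab]
    exact this
  by_cases ha : a ∈ Y <;> by_cases hb : b ∈ Y
  · obtain ⟨x, hx, hxy⟩ := exists_extend_fin hn.pos y
    have hx' : ∀ i < n, x i = a ∨ x i = b := fun i hi => by
      rw [hxy ⟨i, hi⟩]
      exact hmem _
    rw [hab, ← hx, hFG x fun i hi => by rcases hx' i hi with h | h <;> rw [h] <;> assumption]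
    exact (hG.iterOp_pair ha hb (n - 1) x fun i hi => hx' i (by have := hn.pos; omega)).1
      (Nat.Odd.sub_odd hn odd_one)
  · rw [hann b hb y (fun i => (hmem i).symm.imp id fun h => by rwa [h]) hrb]
    exact hrb
  · rw [hann a ha y (fun i => (hmem i).imp id fun h => by rwa [h]) hra]
    exact hra
  · exact hq y fun i => by rcases hmem i with h | h <;> rw [h] <;> assumption

theorem Cond17.not_quasitrivial {n : ℕ} {F : (Fin n → X) → X} {Y : Set X}
    (hY : Cond17 n F Y) (hn : 3 ≤ n) (hodd : Odd n) : ¬ NAryQuasitrivial n F := by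
  obtain ⟨hcard, ⟨G, hG, hFG⟩, -, -⟩ := hY
  obtain ⟨e, heY, hunit, hsq⟩ : ∃ e ∈ Y, (∀ a ∈ Y, G e a = a) ∧ ∀ a ∈ Y, G a a = e := by
    obtain ⟨-, -, -, e, he, hunit, -, hsq⟩ := hG
    exact ⟨e, he, hunit, hsq⟩
  have htwo : 1 < (Y \ {e}).encard := by
    rw [← Set.encard_sdiff_singleton_add_one heY] at hcard
    by_contra hle
    have : (Y \ {e}).encard + 1 ≤ 1 + 1 := by gcongr; exact not_lt.1 hle
    exact absurd (hcard.trans this) (by norm_num)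
  obtain ⟨a, b, ⟨ha, hae⟩, ⟨hb, hbe⟩, hab⟩ := Set.one_lt_encard_iff.1 htwo
  have hae' : a ≠ e := hae
  have hbe' : b ≠ e := hbe
  have hcomm := hG.2.1 a ha b hb
  have hunit' : ∀ c ∈ Y, G c e = c := fun c hc => (hG.2.1 c hc e heY).trans (hunit c hc)
  intro hq
  let x : ℕ → X := fun i => if i = 0 then a else if i = 1 then b else e
  have hval := hFG x fun i _ => by
    simp only [x]
    split_ifs <;> assumption
  have hx : ∀ i, x i = a ∨ x i = b ∨ x i = e := fun i => by
    simp only [x]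
    split_ifs <;> simp
  obtain ⟨m, rfl⟩ : ∃ m, n = m + 3 := ⟨n - 3, by omega⟩
  have heven : Even m := by
    have := Nat.odd_iff.1 hodd
    exact Nat.even_iff.2 (by omega)
  rw [show m + 3 - 1 = m + 1 + 1 by omega, iterOp, iterOp,
    (hG.iterOp_const heY m _ fun i _ => by simp [x]).1 heven] at hval
  change _ = G a (G b e) at hval
  rw [hunit' b hb] at hval
  obtain ⟨i, hi⟩ := hq fun i : Fin (m + 3) => x i
  replace hi : x i = G a b := hi.trans hval
  have h1 := hG.mul_mul_cancel ha hb
  have h2 : G b (G a b) = a := hcomm ▸ hG.mul_mul_cancel hb ha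
  rw [← hi] at h1 h2
  rcases hx i with h | h | h
  · rw [h, hsq a ha] at h1
    exact hbe' h1.symm
  · rw [h, hsq b hb] at h2
    exact hae' h2.symm
  · rw [h, hunit' a ha] at h1
    exact hab h1

theorem Cond17.eq_naryNeutralSet {n : ℕ} {F : (Fin n → X) → X} {Y : Set X}
    (hY : Cond17 n F Y) (hn : 3 ≤ n) (hodd : Odd n) : Y = naryNeutralSet n F := by
  obtain ⟨hcard, ⟨G, hG, hFG⟩, -, hann⟩ := hY
  refine Set.Subset.antisymm (fun e he a p => ?_) fun e he => ?_
  · by_cases ha : a ∈ Y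
    · obtain ⟨x, hx, hxy⟩ := exists_extend_fin hodd.pos (Function.update (fun _ => e) p a)
      have hx' : ∀ i < n, i ≠ p → x i = e := fun i hi hip => by
        rw [hxy ⟨i, hi⟩, Function.update_of_ne]
        exact fun h => hip (congrArg Fin.val h)
      have hxp : x p = a := by rw [hxy p, Function.update_self]
      rw [← hx, hFG x fun i hi => ?_]
      · exact (hG.iterOp_single he ha (n - 1) p (by omega) x hxp
          fun i hi => hx' i (by omega)).1
          (Nat.Odd.sub_odd hodd odd_one)
      · by_cases hip : i = p
        · rwa [hip, hxp]
        · rwa [hx' i hi hip]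
    · refine hann a ha _ (fun i => ?_) ⟨p, Function.update_self ..⟩
      by_cases hip : i = p
      · subst hip
        simp
      · rw [Function.update_of_ne hip]
        exact Or.inr he
  · by_contra heY
    obtain ⟨y, hy⟩ : Y.Nonempty := by
      rw [← Set.encard_pos]
      exact lt_of_lt_of_le (by norm_num) hcard
    have h1 := he y ⟨0, by omega⟩
    have h2 := hann e heY (Function.update (fun _ => e) ⟨0, by omega⟩ y) (fun i => ?_)
      ⟨⟨1, by omega⟩, Function.update_of_ne (by simp) _ _⟩
    · exact heY (h2.symm.trans h1 ▸ hy)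
    · by_cases hi : i = ⟨0, by omega⟩
      · subst hi
        simp [hy]
      · rw [Function.update_of_ne hi]
        exact Or.inl rfl

/-- Characterization of the class `𝓖ⁿ₂ \ 𝓖ⁿₙ`: assuming this class is nonempty, an
associative `F` is quasitrivial on `S^n_2` but not quasitrivial iff `n` is odd and there is
a unique subset `Y ⊆ X` with `|Y| ≥ 3` satisfying (a), (b), (c); moreover `Y = E_F`. -/
theorem stmt_17 {X : Type*} [Nonempty X] (n : ℕ) (hn : 3 ≤ n)
    (hne : ∃ F₀ : (Fin n → X) → X, NAryAssociative n F₀ ∧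
      NAryQuasitrivialOnS n 2 F₀ ∧ ¬NAryQuasitrivial n F₀)
    (F : (Fin n → X) → X) (hF : NAryAssociative n F) :
    ((NAryQuasitrivialOnS n 2 F ∧ ¬NAryQuasitrivial n F) ↔
      (Odd n ∧ ∃! Y : Set X, Cond17 n F Y)) ∧
    ((NAryQuasitrivialOnS n 2 F ∧ ¬NAryQuasitrivial n F) →
      ∀ Y : Set X, Cond17 n F Y → Y = naryNeutralSet n F) := by
  have hfwd : NAryQuasitrivialOnS n 2 F ∧ ¬NAryQuasitrivial n F →
      Odd n ∧ ∃ Y : Set X, Cond17 n F Y := fun h => exists_cond17 hn hF h.1 h.2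
  refine ⟨⟨fun h => ?_, fun ⟨hodd, Y, hY, _⟩ =>
    ⟨hY.quasitrivialOnS hodd, hY.not_quasitrivial hn hodd⟩⟩,
    fun h Y hY => hY.eq_naryNeutralSet hn (hfwd h).1⟩
  obtain ⟨hodd, Y, hY⟩ := hfwd h
  exact ⟨hodd, Y, hY, fun Z hZ =>
    (hZ.eq_naryNeutralSet hn hodd).trans (hY.eq_naryNeutralSet hn hodd).symm⟩
end

section
/- Let X be a nonempty set, n ≥ 2, and let F : X^n → X be an associative and idempotent operation. Then the following are equivalent: (i) F is reducible to an associative and idempotent binary operation G : X^2 → X; (ii) F((n-1)·x, y) = F(x, (n-1)·y) for all x, y ∈ X. Moreover, when (ii) holds, the binary operation G(x,y) = F((n-1)·x, y) is associative, idempotent, and F equals its (n-1)-fold iterate. -/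
variable {X : Type*}

section Reduction

variable {m : ℕ} {F : (Fin (m + 1) → X) → X} {G : X → X → X}

theorem naryCompAt_succ_eq (F : (Fin (m + 1) → X) → X) (x : ℕ → X) (i : ℕ) :
    naryCompAt (m + 1) F x i = F fun j => if (j : ℕ) < i then x j
      else if (j : ℕ) = i then F (fun k => x (i + (k : ℕ))) else x ((j : ℕ) + m) :=
  rfl

theorem NAryAssociative.compAt_zero (hF : NAryAssociative (m + 1) F) (x : ℕ → X) {i : ℕ}
    (hi : i ≤ m) : naryCompAt (m + 1) F x 0 = naryCompAt (m + 1) F x i := by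
  induction i with
  | zero => rfl
  | succ i ih => exact (ih (by omega)).trans (hF x i (by omega))

/-- Two `(2m+1)`-tuples that agree outside a window of length `m + 1`, and on which `F` agrees
inside that window, have the same composite. -/
theorem NAryAssociative.compAt_zero_congr (hF : NAryAssociative (m + 1) F) {x y : ℕ → X} {i : ℕ}
    (hi : i ≤ m) (hlt : ∀ p < i, x p = y p) (hgt : ∀ p, i + m < p → x p = y p)
    (hwin : F (fun k => x (i + (k : ℕ))) = F (fun k => y (i + (k : ℕ)))) :
    naryCompAt (m + 1) F x 0 = naryCompAt (m + 1) F y 0 := by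
  rw [hF.compAt_zero x hi, hF.compAt_zero y hi, naryCompAt_succ_eq, naryCompAt_succ_eq]
  congr 1
  funext j
  split_ifs with h₁ h₂
  · exact hlt _ h₁
  · exact hwin
  · exact hgt _ (by omega)

theorem NAryAssociative.assoc_of_eq (hF : NAryAssociative (m + 1) F)
    (hlast : ∀ a b, F (fun j => if (j : ℕ) < m then a else b) = G a b)
    (hfirst : ∀ a b, F (fun j => if (j : ℕ) = 0 then a else b) = G a b) (a b c : X) :
    G (G a b) c = G a (G b c) := by
  have h := hF.compAt_zero (fun p => if p < m then a else if p = m then b else c) le_rfl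
  rw [naryCompAt_succ_eq, naryCompAt_succ_eq] at h
  convert h using 1
  · rw [← hfirst, ← hlast]
    congr 1
    funext j
    split_ifs <;> first | omega | rfl | skip
    congr 1
    funext k
    have := k.isLt
    split_ifs <;> first | omega | rfl
  · rw [← hlast a, ← hfirst]
    congr 1
    funext j
    have := j.isLt
    split_ifs <;> first | omega | rfl | skip
    congr 1
    funext k
    split_ifs <;> first | omega | rfl

/-- The first entry can be duplicated at the cost of merging the last two entries. -/
theorem NAryAssociative.shift (hF : NAryAssociative (m + 1) F) (hI : ∀ a, F (fun _ => a) = a)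
    (hlast : ∀ a b, F (fun j => if (j : ℕ) < m then a else b) = G a b)
    (hfirst : ∀ a b, F (fun j => if (j : ℕ) = 0 then a else b) = G a b) (x : ℕ → X) :
    F (fun j => x j) = F (fun j => if (j : ℕ) < m then x (j - 1) else G (x (m - 1)) (x m)) := by
  let w : ℕ → ℕ → X := fun k p => if p ≤ k then x (p - 1) else if p ≤ k + m then x k else x (p - m)
  have step : ∀ k ≤ m, naryCompAt (m + 1) F (w 0) 0 = naryCompAt (m + 1) F (w k) 0 := by
    intro k
    induction k with
    | zero => intro _; rfl
    | succ k ih =>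
      intro hk
      refine (ih (by omega)).trans (hF.compAt_zero_congr hk ?_ ?_ ?_)
      · intro p hp
        simp only [w]
        split_ifs <;> first | omega | rfl
      · intro p hp
        simp only [w]
        split_ifs <;> first | omega | rfl
      · trans G (x k) (x (k + 1))
        · rw [← hlast]
          congr 1
          funext j
          have := j.isLt
          simp only [w]
          split_ifs <;> first | omega | rfl | (congr 1; omega)
        · rw [← hfirst]
          congr 1
          funext j
          have := j.isLt
          simp only [w]
          split_ifs <;> first | omega | rfl | (congr 1; omega)
  have h := (step m le_rfl).trans (hF.compAt_zero (w m) le_rfl)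
  rw [naryCompAt_succ_eq, naryCompAt_succ_eq] at h
  convert h using 1
  · congr 1
    funext j
    have := j.isLt
    split_ifs with h₁ h₂
    · omega
    · rw [← hI (x j)]
      congr 1
      funext k
      have := k.isLt
      simp only [w]
      split_ifs <;> first | omega | rfl | (congr 1 <;> omega)
    · simp only [w]
      split_ifs <;> first | omega | rfl | (congr 1; omega)
  · congr 1
    funext j
    have := j.isLt
    split_ifs with h₁ h₂
    · simp only [w]
      split_ifs <;> first | omega | rfl
    · rw [← hfirst]
      congr 1
      funext k
      have := k.isLt
      simp only [w]
      split_ifs <;> first | omega | rfl | (congr 1; omega)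
    · omega

theorem NAryAssociative.reducibleTo (hF : NAryAssociative (m + 1) F) (hm : 1 ≤ m)
    (hI : ∀ a, F (fun _ => a) = a)
    (hlast : ∀ a b, F (fun j => if (j : ℕ) < m then a else b) = G a b)
    (hfirst : ∀ a b, F (fun j => if (j : ℕ) = 0 then a else b) = G a b) :
    NAryReducibleTo (m + 1) F G := by
  intro x
  have key : ∀ t < m, F (fun j => x j) =
      F (fun j => if (j : ℕ) < m then x (j - t) else iterOp G t fun i => x (m - t + i)) := by
    intro t
    induction t with
    | zero =>
      intro _
      congr 1
      funext j
      have := j.isLt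
      simp only [iterOp]
      split_ifs
      · rfl
      · congr 1
        omega
    | succ t ih =>
      intro ht
      rw [ih (by omega), hF.shift hI hlast hfirst
        (fun p => if p < m then x (p - t) else iterOp G t fun i => x (m - t + i))]
      congr 1
      funext j
      rw [if_pos (show m - 1 < m by omega), if_neg (lt_irrefl m)]
      split_ifs
      · congr 1
        omega
      · omega
      · simp only [iterOp]
        congr 1
        · congr 1
          omega
        · congr 1
          funext i
          congr 1
          omega
  obtain ⟨m, rfl⟩ := Nat.exists_eq_add_of_le' hm
  rw [key m (by omega)]
  change _ = G (x 0) (iterOp G m fun i => x (i + 1))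
  rw [← hlast]
  congr 1
  funext j
  split_ifs
  · congr 1
    omega
  · congr 1
    funext i
    congr 1
    omega

end Reduction

theorem iterOp_const {G : X → X → X} (hI : ∀ a, G a a = a) (a : X) (m : ℕ) :
    iterOp G m (fun _ => a) = a := by
  induction m with
  | zero => rfl
  | succ m ih => rw [iterOp, ih, hI]

theorem iterOp_const_last {G : X → X → X} (hG : ∀ a b c, G (G a b) c = G a (G b c))
    (hI : ∀ a, G a a = a) (a b : X) (m : ℕ) :
    iterOp G (m + 1) (fun p => if p < m + 1 then a else b) = G a b := by
  induction m with
  | zero => rfl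
  | succ m ih =>
    rw [iterOp]
    simp only [Nat.add_lt_add_iff_right]
    rw [ih, if_pos (by omega), ← hG, hI]

/-- An associative idempotent `F : X^n → X` is reducible to an associative idempotent
binary operation iff `F ((n-1)·x, y) = F (x, (n-1)·y)` for all `x, y`; in that case
`G (x, y) = F ((n-1)·x, y)` is such a reduction. -/
theorem stmt_18 {X : Type*} [Nonempty X] (n : ℕ) (hn : 2 ≤ n)
    (F : (Fin n → X) → X) (hF : NAryAssociative n F)
    (hI : ∀ a : X, F (fun _ => a) = a) :
    ((∃ G : X → X → X, (∀ a b c, G (G a b) c = G a (G b c)) ∧ (∀ a, G a a = a) ∧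
        NAryReducibleTo n F G) ↔
      (∀ a b : X,
        F (Function.update (fun _ => a) (⟨n - 1, by omega⟩ : Fin n) b) =
        F (Function.update (fun _ => b) (⟨0, by omega⟩ : Fin n) a))) ∧
    ((∀ a b : X,
        F (Function.update (fun _ => a) (⟨n - 1, by omega⟩ : Fin n) b) =
        F (Function.update (fun _ => b) (⟨0, by omega⟩ : Fin n) a)) →
      (∀ a b c : X,
        (fun u v : X => F (Function.update (fun _ => u) (⟨n - 1, by omega⟩ : Fin n) v))
          ((fun u v : X => F (Function.update (fun _ => u) (⟨n - 1, by omega⟩ : Fin n) v)) a b) c =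
        (fun u v : X => F (Function.update (fun _ => u) (⟨n - 1, by omega⟩ : Fin n) v))
          a ((fun u v : X => F (Function.update (fun _ => u) (⟨n - 1, by omega⟩ : Fin n) v)) b c)) ∧
      (∀ a : X, F (Function.update (fun _ => a) (⟨n - 1, by omega⟩ : Fin n) a) = a) ∧
      NAryReducibleTo n F
        (fun u v : X => F (Function.update (fun _ => u) (⟨n - 1, by omega⟩ : Fin n) v))) := by
  obtain ⟨m, rfl⟩ : ∃ m, n = m + 2 := ⟨n - 2, by omega⟩
  have elast : ∀ a b : X, Function.update (fun _ => a) (⟨m + 2 - 1, by omega⟩ : Fin (m + 2)) b =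
      fun j : Fin (m + 2) => if (j : ℕ) < m + 1 then a else b := by
    intro a b
    funext j
    have := j.isLt
    simp only [Function.update_apply, Fin.ext_iff]
    split_ifs <;> first | omega | rfl
  have efirst : ∀ a b : X, Function.update (fun _ => b) (⟨0, by omega⟩ : Fin (m + 2)) a =
      fun j : Fin (m + 2) => if (j : ℕ) = 0 then a else b := by
    intro a b
    funext j
    simp only [Function.update_apply, Fin.ext_iff]
  simp only [elast, efirst]
  let G : X → X → X := fun a b => F fun j => if (j : ℕ) < m + 1 then a else b
  have main (h : ∀ a b, G a b = F fun j => if (j : ℕ) = 0 then a else b) :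
      (∀ a b c, G (G a b) c = G a (G b c)) ∧ (∀ a, G a a = a) ∧ NAryReducibleTo (m + 2) F G :=
    ⟨hF.assoc_of_eq (fun _ _ => rfl) fun a b => (h a b).symm, fun a => by simp [G, hI],
      hF.reducibleTo (by omega) hI (fun _ _ => rfl) fun a b => (h a b).symm⟩
  refine ⟨⟨?_, fun h => ⟨G, main h⟩⟩, main⟩
  rintro ⟨G, hG, hGI, hred⟩ a b
  rw [hred (fun p => if p < m + 1 then a else b), hred (fun p => if p = 0 then a else b)]
  refine (iterOp_const_last hG hGI a b m).trans ?_
  change _ = G a (iterOp G m fun _ => b)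
  rw [iterOp_const hGI]
end
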